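/- Let G be a finite simple graph with maximum degree Δ ≥ 1, and suppose some connected component of G is isomorphic to the star graph S_{Δ+1} on Δ+1 vertices (whose center thus has degree Δ in G). Then the critical coupling satisfies τ_c(G) = 1/Δ. -/

import Mathlib

open Matrix

/-- The critical coupling of a finite simple graph `G`:
`τ_c(G) = sSup {t | 0 ≤ t ∧ ∀ τ ∈ [0, t), I + τ•A is invertible and
(I + τ•A)⁻¹ *ᵥ 𝟙 has all entries strictly positive}`. -/
noncomputable def criticalCoupling {V : Type*} [Fintype V] [DecidableEq V]
    (G : SimpleGraph V) [DecidableRel G.Adj] : ℝ :=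
  sSup {t : ℝ | 0 ≤ t ∧ ∀ τ ∈ Set.Ico (0 : ℝ) t,
    IsUnit (1 + τ • G.adjMatrix ℝ) ∧
    ∀ i, 0 < ((1 + τ • G.adjMatrix ℝ)⁻¹ *ᵥ fun _ => (1 : ℝ)) i}

lemma cc_row {V : Type*} [Fintype V] [DecidableEq V]
    (G : SimpleGraph V) [DecidableRel G.Adj] (τ : ℝ) (v : V → ℝ) (i : V) :
    ((1 + τ • G.adjMatrix ℝ) *ᵥ v) i = v i + τ * ∑ j ∈ G.neighborFinset i, v j := by
  rw [Matrix.add_mulVec, Matrix.one_mulVec, Matrix.smul_mulVec, Pi.add_apply, Pi.smul_apply,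
    SimpleGraph.adjMatrix_mulVec_apply, smul_eq_mul]

lemma cc_sol {V : Type*} [Fintype V] [DecidableEq V]
    (G : SimpleGraph V) [DecidableRel G.Adj] (τ : ℝ) (h : IsUnit (1 + τ • G.adjMatrix ℝ)) (i : V) :
    ((1 + τ • G.adjMatrix ℝ)⁻¹ *ᵥ fun _ => (1 : ℝ)) i
      + τ * ∑ j ∈ G.neighborFinset i, ((1 + τ • G.adjMatrix ℝ)⁻¹ *ᵥ fun _ => (1 : ℝ)) j = 1 := by
  rw [← cc_row, Matrix.mulVec_mulVec, Matrix.mul_nonsing_inv _ ((Matrix.isUnit_iff_isUnit_det _).1 h),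
    Matrix.one_mulVec]

lemma cc_unit {V : Type*} [Fintype V] [DecidableEq V]
    (G : SimpleGraph V) [DecidableRel G.Adj] (τ : ℝ) (h0 : 0 ≤ τ) (h1 : τ * G.maxDegree < 1) :
    IsUnit (1 + τ • G.adjMatrix ℝ) := by
  rw [Matrix.isUnit_iff_isUnit_det, isUnit_iff_ne_zero]
  apply det_ne_zero_of_sum_row_lt_diag
  intro k
  have hd : ‖(1 + τ • G.adjMatrix ℝ) k k‖ = 1 := by simp
  rw [hd]
  refine lt_of_le_of_lt ?_ h1
  have hle : ((G.degree k : ℕ) : ℝ) ≤ G.maxDegree := by exact_mod_cast G.degree_le_maxDegree k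
  calc ∑ j ∈ Finset.univ.erase k, ‖(1 + τ • G.adjMatrix ℝ) k j‖
      = ∑ j ∈ Finset.univ.erase k, τ * G.adjMatrix ℝ k j := by
        apply Finset.sum_congr rfl
        intro j hj
        have hjk : k ≠ j := (Finset.ne_of_mem_erase hj).symm
        simp only [Matrix.add_apply, Matrix.one_apply_ne hjk, Matrix.smul_apply, zero_add,
          smul_eq_mul, Real.norm_eq_abs, SimpleGraph.adjMatrix_apply]
        split_ifs <;> simp [abs_of_nonneg h0]
    _ ≤ ∑ j, τ * G.adjMatrix ℝ k j := by
        apply Finset.sum_le_sum_of_subset_of_nonneg (Finset.erase_subset _ _)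
        intro j _ _
        rw [SimpleGraph.adjMatrix_apply]
        split_ifs <;> simp [h0]
    _ = τ * G.degree k := by
        rw [← Finset.mul_sum]
        congr 1
        simp [SimpleGraph.adjMatrix_apply, ← SimpleGraph.card_neighborFinset_eq_degree,
          SimpleGraph.neighborFinset_eq_filter]
    _ ≤ _ := by gcongr

lemma cc_pos {V : Type*} [Fintype V] [DecidableEq V]
    (G : SimpleGraph V) [DecidableRel G.Adj] (τ : ℝ) (h0 : 0 ≤ τ) (h1 : τ * G.maxDegree < 1)
    (x : V → ℝ) (hx : ∀ i, x i + τ * ∑ j ∈ G.neighborFinset i, x j = 1) (i : V) : 0 < x i := by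
  by_contra hneg
  push Not at hneg
  haveI : Nonempty V := ⟨i⟩
  obtain ⟨a, ha⟩ := Finite.exists_max x
  obtain ⟨b, hb⟩ := Finite.exists_min x
  have hm : x b ≤ 0 := (hb i).trans hneg
  have hdeg : ∀ k, ((G.degree k : ℕ) : ℝ) ≤ G.maxDegree := fun k => by
    exact_mod_cast G.degree_le_maxDegree k
  have hS1 : (G.degree a : ℝ) * x b ≤ ∑ j ∈ G.neighborFinset a, x j := by
    rw [← SimpleGraph.card_neighborFinset_eq_degree, ← nsmul_eq_mul]
    exact Finset.card_nsmul_le_sum _ _ _ fun j _ => hb j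
  have hS2 : ∑ j ∈ G.neighborFinset b, x j ≤ (G.degree b : ℝ) * x a := by
    rw [← SimpleGraph.card_neighborFinset_eq_degree, ← nsmul_eq_mul]
    exact Finset.sum_le_card_nsmul _ _ _ fun j _ => ha j
  have hM : 0 ≤ x a := by
    by_contra hlt
    push Not at hlt
    have : (G.degree b : ℝ) * x a ≤ 0 := mul_nonpos_of_nonneg_of_nonpos (by positivity) hlt.le
    have h3 : τ * ∑ j ∈ G.neighborFinset b, x j ≤ 0 :=
      mul_nonpos_of_nonneg_of_nonpos h0 (hS2.trans this)
    linarith [hx b]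
  have hq : 0 ≤ τ * G.maxDegree := by positivity
  have e1 : τ * G.maxDegree * x b ≤ τ * ∑ j ∈ G.neighborFinset a, x j := by
    rw [mul_assoc]
    exact mul_le_mul_of_nonneg_left
      ((mul_le_mul_of_nonpos_right (hdeg a) hm).trans hS1) h0
  have e2 : τ * ∑ j ∈ G.neighborFinset b, x j ≤ τ * G.maxDegree * x a := by
    rw [mul_assoc]
    exact mul_le_mul_of_nonneg_left
      (hS2.trans (mul_le_mul_of_nonneg_right (hdeg b) hM)) h0
  generalize τ * (G.maxDegree : ℝ) = q at *
  have f1 : x a ≤ 1 - q * x b := by linarith [hx a]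
  have f2 : 1 - q * x a ≤ x b := by linarith [hx b]
  have f3 : q * x a ≤ q * (1 - q * x b) := mul_le_mul_of_nonneg_left f1 hq
  have f4 : 0 ≤ 1 - q * q := by nlinarith
  have f5 : (1 - q * q) * x b ≤ 0 := mul_nonpos_of_nonneg_of_nonpos f4 hm
  nlinarith

/-- If `G` has maximum degree `Δ ≥ 1` and some connected component of `G` is
isomorphic to the star `S_{Δ+1}` — i.e., there is a vertex `c` of degree `Δ` all of whose
neighbours have `c` as their only neighbour — then `τ_c(G) = 1/Δ`. -/
theorem criticalCoupling_of_star_component {V : Type*} [Fintype V] [DecidableEq V]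
    (G : SimpleGraph V) [DecidableRel G.Adj] (hΔ : 1 ≤ G.maxDegree)
    (c : V) (hc : G.degree c = G.maxDegree)
    (hstar : ∀ j, G.Adj c j → ∀ k, G.Adj j k → k = c) :
    criticalCoupling G = 1 / (G.maxDegree : ℝ) := by
  have hD : (1 : ℝ) ≤ G.maxDegree := by exact_mod_cast hΔ
  have hDpos : (0 : ℝ) < G.maxDegree := by linarith
  have hnb : ∀ j, G.Adj c j → G.neighborFinset j = {c} := by
    intro j hj
    ext k
    simp only [SimpleGraph.mem_neighborFinset, Finset.mem_singleton]
    exact ⟨hstar j hj k, fun h => h ▸ hj.symm⟩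
  unfold criticalCoupling
  apply IsGreatest.csSup_eq
  constructor
  · refine ⟨by positivity, fun τ hτ => ?_⟩
    have h1 : τ * G.maxDegree < 1 := (lt_div_iff₀ hDpos).1 hτ.2
    have hu := cc_unit G τ hτ.1 h1
    exact ⟨hu, fun i => cc_pos G τ hτ.1 h1 _ (cc_sol G τ hu) i⟩
  · rintro t ⟨_, ht⟩
    by_contra hlt
    push Not at hlt
    obtain ⟨hu, hpos⟩ := ht (1 / (G.maxDegree : ℝ)) ⟨by positivity, hlt⟩
    rcases hΔ.eq_or_lt with h1 | h2
    · rw [← h1] at hu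
      have hinj := Matrix.mulVec_injective_of_isUnit hu
      have hz : (1 + (1 / ((1 : ℕ) : ℝ)) • G.adjMatrix ℝ) *ᵥ
          (fun i => if i = c then 1 else if G.Adj c i then (-1 : ℝ) else 0) = 0 := by
        ext i
        rw [cc_row]
        by_cases hi : i = c
        · subst hi
          have : ∑ j ∈ G.neighborFinset i,
              (if j = i then 1 else if G.Adj i j then (-1 : ℝ) else 0)
              = ∑ j ∈ G.neighborFinset i, (-1 : ℝ) := by
            apply Finset.sum_congr rfl
            intro j hj
            rw [SimpleGraph.mem_neighborFinset] at hj
            simp [hj, hj.ne']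
          rw [this]
          simp [hc, ← h1]
        · by_cases hi2 : G.Adj c i
          · simp [hnb i hi2, hi, hi2]
          · have : ∑ j ∈ G.neighborFinset i,
              (if j = c then 1 else if G.Adj c j then (-1 : ℝ) else 0) = 0 := by
              apply Finset.sum_eq_zero
              intro j hj
              rw [SimpleGraph.mem_neighborFinset] at hj
              have a1 : j ≠ c := by
                rintro rfl
                exact hi2 hj.symm
              have a2 : ¬ G.Adj c j := fun h => hi (hstar j h i hj.symm)
              simp [a1, a2]
            rw [this]
            simp [hi, hi2]
      have h3 := hinj (hz.trans (Matrix.mulVec_zero _).symm)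
      have h4 := congrFun h3 c
      simp at h4
    · have hsol := cc_sol G _ hu
      have hp := hpos c
      generalize ((1 + (1 / (G.maxDegree : ℝ)) • G.adjMatrix ℝ)⁻¹ *ᵥ fun _ => (1 : ℝ)) = x at *
      have hl : ∑ j ∈ G.neighborFinset c, x j
          = (G.maxDegree : ℝ) * (1 - 1 / (G.maxDegree : ℝ) * x c) := by
        rw [← hc, ← nsmul_eq_mul, ← SimpleGraph.card_neighborFinset_eq_degree, ← Finset.sum_const]
        apply Finset.sum_congr rfl
        intro j hj
        rw [SimpleGraph.mem_neighborFinset] at hj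
        have := hsol j
        rw [hnb j hj, Finset.sum_singleton] at this
        rw [SimpleGraph.card_neighborFinset_eq_degree, hc]
        linarith
      have h5 := hsol c
      rw [hl] at h5
      have h6 : (1 : ℝ) < G.maxDegree := by exact_mod_cast h2
      field_simp at h5
      nlinarith
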